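/- (Asynchronous Convergence) Let ι = {1, …, m} be a finite index set, and for each i ∈ ι let E_i be a topological space; let E = ∏_{i∈ι} E_i carry the product topology. Let H : E → E have components H_i : E → E_i, and let x* ∈ E. Suppose there are sets E^k_i ⊆ E_i for k ∈ ℕ, and write E^k = ∏_{i∈ι} E^k_i, such that: (C1/C2) H(E^k) ⊆ E^{k+1} ⊆ E^k for all k; (C3) every sequence (y^k)_{k∈ℕ} with y^k ∈ E^k for all k converges to x*. Let s_i : ℕ → ℕ for each i ∈ ι and I : ℕ → Set ι satisfy: (R1) s_i(k) ≤ k − 1 for all k ≥ 1; (R2) s_i(k) → ∞ as k → ∞; (R3) for each i, the set {k ∈ ℕ : i ∈ I(k)} is infinite. Define the asynchronous iterates by choosing x^0 ∈ E^0 and, for k ≥ 1, setting x^k_i = H_i(x^{s_1(k)}_1, …, x^{s_m(k)}_m) if i ∈ I(k) and x^k_i = x^{k−1}_i otherwise. Then x^k → x* in the product topology. -/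

import Mathlib

open Filter Topology Set

/-- Asynchronous Convergence (Baudet / Bertsekas / Frommer–Szyld):
under the box, nested-sets and synchronous-convergence conditions, and the
standard regularity conditions on the delays `s` and update sets `I`, the
asynchronous iterates of `H` converge to the fixed point `x*` in the
product topology. -/
theorem asynchronous_convergence
    {m : ℕ} {E : Fin m → Type*} [∀ i, TopologicalSpace (E i)]
    (H : (∀ i, E i) → (∀ i, E i)) (xstar : ∀ i, E i)
    (Ek : ℕ → ∀ i, Set (E i))
    -- (C1/C2): H(E^k) ⊆ E^{k+1} ⊆ E^k (the box condition is built into the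
    -- definition of E^k as a product of component sets)
    (hC2a : ∀ k, H '' (Set.univ.pi (Ek k)) ⊆ Set.univ.pi (Ek (k + 1)))
    (hC2b : ∀ k, Set.univ.pi (Ek (k + 1)) ⊆ Set.univ.pi (Ek k))
    -- (C3): synchronous convergence condition
    (hC3 : ∀ y : ℕ → ∀ i, E i, (∀ k, y k ∈ Set.univ.pi (Ek k)) →
      Tendsto y atTop (𝓝 xstar))
    (s : Fin m → ℕ → ℕ) (I : ℕ → Set (Fin m))
    -- (R1): a worker's current state cannot be based on future values
    (hR1 : ∀ i k, 1 ≤ k → s i k ≤ k - 1)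
    -- (R2): workers don't stop permanently mid-run
    (hR2 : ∀ i, Tendsto (s i) atTop atTop)
    -- (R3): no component stops being updated or communicated
    (hR3 : ∀ i, {k : ℕ | i ∈ I k}.Infinite)
    -- the asynchronous iterates
    (x : ℕ → ∀ i, E i) (hx0 : x 0 ∈ Set.univ.pi (Ek 0))
    (hxupd : ∀ k, 1 ≤ k → ∀ i, i ∈ I k → x k i = H (fun j => x (s j k) j) i)
    (hxkeep : ∀ k, 1 ≤ k → ∀ i, i ∉ I k → x k i = x (k - 1) i) :
    Tendsto x atTop (𝓝 xstar) := by
  have hstep : ∀ k, ∀ y ∈ univ.pi (Ek k), H y ∈ univ.pi (Ek (k + 1)) :=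
    fun k y hy => hC2a k (mem_image_of_mem H hy)
  have hall : ∀ n, x n ∈ univ.pi (Ek 0) := by
    intro n
    induction n using Nat.strong_induction_on with
    | _ n ih =>
      rcases Nat.eq_zero_or_pos n with rfl | hn
      · exact hx0
      · intro i _
        by_cases hi : i ∈ I n
        · rw [hxupd n hn i hi]
          refine hC2b 0 (hstep 0 _ fun j _ => ?_) i trivial
          have hj := hR1 j n hn
          exact ih (s j n) (by omega) j trivial
        · rw [hxkeep n hn i hi]
          exact ih (n - 1) (by omega) i trivial
  have hev : ∀ k, ∀ᶠ n in atTop, x n ∈ univ.pi (Ek k) := by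
    intro k
    induction k with
    | zero => exact Eventually.of_forall hall
    | succ k ih =>
      have hdelay : ∀ᶠ n in atTop, ∀ j, x (s j n) ∈ univ.pi (Ek k) :=
        eventually_all.2 fun j => (hR2 j).eventually ih
      obtain ⟨N, hN⟩ := eventually_atTop.1 hdelay
      have hupd : ∀ n, N ≤ n → 1 ≤ n → ∀ i, i ∈ I n → x n i ∈ Ek (k + 1) i := by
        intro n hn hn1 i hi
        rw [hxupd n hn1 i hi]
        exact hstep k _ (fun j _ => hN n hn j j trivial) i trivial
      have hcomp : ∀ i, ∀ᶠ n in atTop, x n i ∈ Ek (k + 1) i := by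
        intro i
        obtain ⟨M, hM, hNM⟩ := (hR3 i).exists_gt N
        refine eventually_atTop.2 ⟨M, fun n hn => ?_⟩
        induction n, hn using Nat.le_induction with
        | base => exact hupd M hNM.le (by omega) i hM
        | succ n hn ihn =>
          by_cases hi : i ∈ I (n + 1)
          · exact hupd (n + 1) (by omega) (by omega) i hi
          · rw [hxkeep (n + 1) (by omega) i hi]
            exact ihn
      filter_upwards [eventually_all.2 hcomp] with n hn i _ using hn i
  intro U hU
  obtain ⟨k, hk⟩ : ∃ k, univ.pi (Ek k) ⊆ U := by
    by_contra! h
    choose y hy hyU using fun k => not_subset.1 (h k)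
    obtain ⟨n, hn⟩ := ((hC3 y hy).eventually hU).exists
    exact hyU n hn
  exact (hev k).mono fun n hn => hk hn
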